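/- arXiv:2103.02860 — 2 statements merged into one kernel-verified Lean document; each statement's English description precedes it below -/
import Mathlib

section
/- Deterministic stability of sample quantiles under bounded perturbation with corruptions (Lemma C.6). Let X_0,…,X_m be real numbers, let B ⊆ {1,…,m} with card(B) = ⌊αm⌋ for some 0 < α < 1/2, and let δ > 0. Let ε_0,…,ε_m be real numbers with |ε_j| ≤ δ for all j ∉ B (the ε_j for j ∈ B are arbitrary). Fix τ ∈ (0,1). Let X̂^τ be any τ-quantile of (X_0,…,X_m), let X̂^τ_ε be any τ-quantile of (X_0+ε_0,…,X_m+ε_m), and let X̂^{B,(τ−α)/(1−α)} and X̂^{B,τ/(1−α)} be, respectively, any ((τ−α)/(1−α))-quantile and any (τ/(1−α))-quantile of the subfamily (X_j)_{j∈{0,…,m}∖B}. Then |X̂^τ_ε − X̂^τ| ≤ |X̂^{B,(τ−α)/(1−α)} − X̂^{B,τ/(1−α)}| + 2δ. -/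
open MeasureTheory ProbabilityTheory Real Filter Finset Asymptotics
open scoped ENNReal InnerProductSpace Topology

noncomputable section

/-- The standard normal probability density function. -/
def stdPDF (x : ℝ) : ℝ := Real.exp (-x ^ 2 / 2) / Real.sqrt (2 * Real.pi)

/-- The standard normal cumulative distribution function. -/
def stdCDF (x : ℝ) : ℝ := ∫ t in Set.Iic x, stdPDF t

/-- The inverse of the standard normal cdf (the standard normal quantile function). -/
def stdQuantile : ℝ → ℝ := Function.invFun stdCDF

/-- `Δ_k = Φ⁻¹(k/(K+1))`. -/
def Δq (K k : ℕ) : ℝ := stdQuantile ((k : ℝ) / ((K : ℝ) + 1))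

/-- `q` is a median of the family `y`. -/
def IsMedian {N : ℕ} (y : Fin N → ℝ) (q : ℝ) : Prop :=
  (N : ℝ) / 2 ≤ ((Finset.univ.filter fun j => y j ≤ q).card : ℝ) ∧
    (N : ℝ) / 2 ≤ ((Finset.univ.filter fun j => q ≤ y j).card : ℝ)

/-- The sample mean of a batch. -/
def batchMean (n : ℕ) (x : Fin n → ℝ) : ℝ := (∑ i, x i) / n

/-- The sample standard deviation of a batch. -/
def sampleSD (n : ℕ) (x : Fin n → ℝ) : ℝ :=
  Real.sqrt ((∑ i, (x i - batchMean n x) ^ 2) / n)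

/-- The VRMOM estimator built from the reports `Y`, a median `q` of the reports and the
master standard deviation estimate `sh` (formula (11) of the paper). -/
def vrmomOf (mm n K : ℕ) (Y : Fin (mm + 1) → ℝ) (q sh : ℝ) : ℝ :=
  q - sh / (((mm : ℝ) + 1) * Real.sqrt n * ∑ k ∈ Finset.Icc 1 K, stdPDF (Δq K k)) *
      ∑ j : Fin (mm + 1), ∑ k ∈ Finset.Icc 1 K,
        ((if Y j ≤ q + sh * Δq K k / Real.sqrt n then (1 : ℝ) else 0) - (k : ℝ) / ((K : ℝ) + 1))

/-- The asymptotic variance constant `σ_K²/σ²` of the VRMOM estimator. -/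
def vrmomVarConst (K : ℕ) : ℝ :=
  (∑ k1 ∈ Finset.Icc 1 K, ∑ k2 ∈ Finset.Icc 1 K,
      min ((k1 : ℝ) / ((K : ℝ) + 1)) ((k2 : ℝ) / ((K : ℝ) + 1)) *
        (1 - max ((k1 : ℝ) / ((K : ℝ) + 1)) ((k2 : ℝ) / ((K : ℝ) + 1)))) /
    (∑ k ∈ Finset.Icc 1 K, stdPDF (Δq K k)) ^ 2


/-- `q` is a `τ`-quantile of the family `y` restricted to the index set `s`. -/
def IsQuantile {ι : Type*} (s : Finset ι) (y : ι → ℝ) (τ q : ℝ) : Prop :=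
  τ * s.card ≤ ((s.filter fun j => y j ≤ q).card : ℝ) ∧
    (1 - τ) * s.card ≤ ((s.filter fun j => q ≤ y j).card : ℝ)

theorem card_add_card_filter_le {ι : Type*} {s t : Finset ι} {p : ι → Prop} [DecidablePred p]
    (hts : t ⊆ s) (ht : ∀ j ∈ t, ¬ p j) :
    (t.card : ℝ) + ((s.filter p).card : ℝ) ≤ s.card := by
  classical
  have hdisj : Disjoint t (s.filter p) :=
    Finset.disjoint_left.2 fun j hj hj' => ht j hj (Finset.mem_filter.1 hj').2
  have hle := Finset.card_le_card (Finset.union_subset hts (Finset.filter_subset p s))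
  rw [Finset.card_union_of_disjoint hdisj] at hle
  exact_mod_cast hle

/-- A `τ`-quantile is at most `c` if more than a proportion `τ` of the family is. -/
theorem IsQuantile.le_of_lt_card {ι : Type*} {s t : Finset ι} {y : ι → ℝ} {τ q c : ℝ}
    (h : IsQuantile s y τ q) (hts : t ⊆ s) (ht : ∀ j ∈ t, y j ≤ c)
    (hcard : τ * s.card < t.card) : q ≤ c := by
  by_contra! hc
  have := card_add_card_filter_le (p := fun j => q ≤ y j) hts
    fun j hj => not_le.2 ((ht j hj).trans_lt hc)
  linarith [h.2]

/-- A `τ`-quantile is at least `c` if more than a proportion `1 - τ` of the family is. -/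
theorem IsQuantile.ge_of_lt_card {ι : Type*} {s t : Finset ι} {y : ι → ℝ} {τ q c : ℝ}
    (h : IsQuantile s y τ q) (hts : t ⊆ s) (ht : ∀ j ∈ t, c ≤ y j)
    (hcard : (1 - τ) * s.card < t.card) : c ≤ q := by
  by_contra! hc
  have := card_add_card_filter_le (p := fun j => y j ≤ q) hts
    fun j hj => not_le.2 (hc.trans_le (ht j hj))
  linarith [h.1]

/-- **Lemma C.6 (Deterministic stability of sample quantiles under bounded perturbation
with corruptions).** If the perturbations `ε_j` are bounded by `δ` off the corrupted set `B`
(of size `⌊αm⌋` with `0 < α < 1/2`), then any `τ`-quantile of the perturbed family is within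
`|X̂^{B,(τ-α)/(1-α)} - X̂^{B,τ/(1-α)}| + 2δ` of any `τ`-quantile of the original family. -/
theorem quantile_stability_with_corruptions
    (m : ℕ) (X : Fin (m + 1) → ℝ)
    (B : Finset (Fin (m + 1))) (hB0 : (0 : Fin (m + 1)) ∉ B)
    (α : ℝ) (hα0 : 0 < α) (hα1 : α < 1 / 2) (hBcard : B.card = ⌊α * (m : ℝ)⌋₊)
    (δ : ℝ) (hδ : 0 < δ)
    (ε : Fin (m + 1) → ℝ) (hε : ∀ j ∉ B, |ε j| ≤ δ)
    (τ : ℝ) (hτ : τ ∈ Set.Ioo (0 : ℝ) 1)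
    (q qε q₁ q₂ : ℝ)
    (hq : IsQuantile Finset.univ X τ q)
    (hqε : IsQuantile Finset.univ (fun j => X j + ε j) τ qε)
    (hq₁ : IsQuantile (Finset.univ \ B) X ((τ - α) / (1 - α)) q₁)
    (hq₂ : IsQuantile (Finset.univ \ B) X (τ / (1 - α)) q₂) :
    |qε - q| ≤ |q₁ - q₂| + 2 * δ := by
  obtain ⟨hτ0, hτ1⟩ := hτ
  have hα : 0 < 1 - α := by linarith
  have hB : (B.card : ℝ) ≤ α * m := by
    rw [hBcard]
    exact Nat.floor_le (by positivity)
  have huniv : ((Finset.univ : Finset (Fin (m + 1))).card : ℝ) = m + 1 := by simp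
  have hG : ((Finset.univ \ B).card : ℝ) = m + 1 - B.card := by
    rw [Finset.cast_card_sdiff (Finset.subset_univ B), huniv]
  have hclean : ∀ r : ℝ, 0 < r →
      r * (Finset.univ : Finset (Fin (m + 1))).card < r / (1 - α) * (Finset.univ \ B).card := by
    intro r hr
    rw [huniv, hG, div_mul_eq_mul_div, lt_div_iff₀ hα, mul_assoc]
    exact mul_lt_mul_of_pos_left (by linarith) hr
  have hupper := (hclean τ hτ0).trans_le hq₂.1
  have hlower := (hclean (1 - τ) (by linarith)).trans_le
    ((by field_simp; ring : (1 - τ) / (1 - α) = 1 - (τ - α) / (1 - α)) ▸ hq₁.2)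
  have h₁ : q₁ ≤ q := hq.ge_of_lt_card (Finset.subset_univ _)
    (fun j hj => (Finset.mem_filter.1 hj).2) hlower
  have h₂ : q ≤ q₂ := hq.le_of_lt_card (Finset.subset_univ _)
    (fun j hj => (Finset.mem_filter.1 hj).2) hupper
  have h₃ : q₁ - δ ≤ qε := by
    refine hqε.ge_of_lt_card (Finset.subset_univ _) (fun j hj => ?_) hlower
    obtain ⟨hj, hle⟩ := Finset.mem_filter.1 hj
    linarith [(abs_le.1 (hε j (Finset.mem_sdiff.1 hj).2)).1]
  have h₄ : qε ≤ q₂ + δ := by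
    refine hqε.le_of_lt_card (Finset.subset_univ _) (fun j hj => ?_) hupper
    obtain ⟨hj, hle⟩ := Finset.mem_filter.1 hj
    linarith [(abs_le.1 (hε j (Finset.mem_sdiff.1 hj).2)).2]
  have habs := neg_abs_le (q₁ - q₂)
  rw [abs_le]
  constructor <;> linarith

end
end

section
/- Limit of the VRMOM asymptotic variance constant (part of Theorem 1 and Lemma B.1). For each integer K ≥ 1, set τ_k = k/(K+1), Δ_k = Φ^{−1}(τ_k), and σ_K² = [ Σ_{k₁,k₂=1}^K min(τ_{k₁}, τ_{k₂}) (1 − max(τ_{k₁}, τ_{k₂})) ] / [ Σ_{k=1}^K ψ(Δ_k) ]². Then σ_K² → π/3 as K → ∞. -/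
open MeasureTheory ProbabilityTheory Real Filter Finset Asymptotics
open scoped ENNReal InnerProductSpace Topology

noncomputable section

theorem tendsto_riemannSum_of_continuousOn_Ioo {g : ℝ → ℝ} {C : ℝ} (hC : ∀ x, |g x| ≤ C)
    (hg : ContinuousOn g (Set.Ioo 0 1)) :
    Tendsto (fun K : ℕ => (∑ k ∈ range (K + 1), g (k / ((K : ℝ) + 1))) / ((K : ℝ) + 1)) atTop
      (𝓝 (∫ x in Set.Ioo (0 : ℝ) 1, g x)) := by
  have hmeas (K : ℕ) : Measurable fun x : ℝ => g (⌊((K : ℝ) + 1) * x⌋₊ / ((K : ℝ) + 1)) :=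
    (measurable_from_nat (f := fun n : ℕ => g (n / ((K : ℝ) + 1)))).comp
      (Nat.measurable_floor.comp (measurable_const_mul _))
  have hint (K : ℕ) (a b : ℝ) :
      IntervalIntegrable (fun x : ℝ => g (⌊((K : ℝ) + 1) * x⌋₊ / ((K : ℝ) + 1))) volume a b :=
    (intervalIntegrable_const (c := C)).mono_fun' (hmeas K).aestronglyMeasurable
      (ae_of_all _ fun _ => hC _)
  have hsum (K : ℕ) : ∫ x in (0 : ℝ)..1, g (⌊((K : ℝ) + 1) * x⌋₊ / ((K : ℝ) + 1)) =
      (∑ k ∈ range (K + 1), g (k / ((K : ℝ) + 1))) / ((K : ℝ) + 1) := by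
    have hK : (0 : ℝ) < (K : ℝ) + 1 := by positivity
    have h := intervalIntegral.sum_integral_adjacent_intervals (n := K + 1)
      (a := fun k : ℕ => (k : ℝ) / ((K : ℝ) + 1)) fun k _ => hint K _ _
    have h1 : ((K + 1 : ℕ) : ℝ) / ((K : ℝ) + 1) = 1 := by
      push_cast
      exact div_self hK.ne'
    simp only [h1, Nat.cast_zero, zero_div] at h
    rw [← h, Finset.sum_div]
    refine Finset.sum_congr rfl fun k _ => ?_
    have hle : (k : ℝ) / ((K : ℝ) + 1) ≤ ((k + 1 : ℕ) : ℝ) / ((K : ℝ) + 1) := by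
      gcongr
      simp
    rw [intervalIntegral.integral_congr_Ioo_of_le (g := fun _ => g (k / ((K : ℝ) + 1))) hle,
      intervalIntegral.integral_const, smul_eq_mul]
    · push_cast
      ring
    · rintro x ⟨hx1, hx2⟩
      rw [div_lt_iff₀' hK] at hx1
      rw [lt_div_iff₀' hK] at hx2
      push_cast at hx2
      have : ⌊((K : ℝ) + 1) * x⌋₊ = k :=
        (Nat.floor_eq_iff ((Nat.cast_nonneg k).trans hx1.le)).2 ⟨hx1.le, hx2⟩
      simp only [this]
  simp only [← hsum]
  rw [← integral_Ioc_eq_integral_Ioo, ← intervalIntegral.integral_of_le zero_le_one]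
  refine intervalIntegral.tendsto_integral_filter_of_dominated_convergence (fun _ => C)
    (Eventually.of_forall fun K => (hmeas K).aestronglyMeasurable)
    (Eventually.of_forall fun K => ae_of_all _ fun x _ => hC _) intervalIntegrable_const ?_
  filter_upwards [volume.ae_ne (1 : ℝ)] with x hx1 hx
  rw [Set.uIoc_of_le zero_le_one] at hx
  have hmem : x ∈ Set.Ioo (0 : ℝ) 1 := ⟨hx.1, lt_of_le_of_ne hx.2 hx1⟩
  refine ((hg.continuousAt (isOpen_Ioo.mem_nhds hmem)).tendsto).comp ?_
  have hK : Tendsto (fun K : ℕ => (K : ℝ) + 1) atTop atTop :=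
    tendsto_atTop_add_const_right _ _ tendsto_natCast_atTop_atTop
  simpa only [Function.comp_def, mul_comm] using
    (tendsto_nat_floor_mul_div_atTop hmem.1.le).comp hK

theorem sum_min_mul_one_sub_max {M : ℝ} (hM : 0 < M) (n : ℕ) :
    ∑ i ∈ Icc 1 n, ∑ j ∈ Icc 1 n,
        min ((i : ℝ) / M) ((j : ℝ) / M) * (1 - max ((i : ℝ) / M) ((j : ℝ) / M)) =
      (M * n * (n + 1) * (2 * n + 1) / 6 - (n : ℝ) ^ 2 * (n + 1) ^ 2 / 4) / M ^ 2 := by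
  have hlin (n : ℕ) : ∑ i ∈ Icc 1 n, (i : ℝ) / M = n * (n + 1) / 2 / M := by
    induction n with
    | zero => simp
    | succ n ih =>
      rw [sum_Icc_succ_top (by simp), ih]
      push_cast
      ring
  induction n with
  | zero => simp
  | succ n ih =>
    have hle {i : ℕ} (hi : i ∈ Icc 1 n) : (i : ℝ) / M ≤ ((n + 1 : ℕ) : ℝ) / M := by
      have : i ≤ n + 1 := (mem_Icc.1 hi).2.trans n.le_succ
      gcongr
    have hrow : ∑ i ∈ Icc 1 n, min ((i : ℝ) / M) (((n + 1 : ℕ) : ℝ) / M) *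
        (1 - max ((i : ℝ) / M) (((n + 1 : ℕ) : ℝ) / M)) =
          n * (n + 1) / 2 / M * (1 - ((n + 1 : ℕ) : ℝ) / M) := by
      rw [← hlin, sum_mul]
      exact sum_congr rfl fun i hi => by rw [min_eq_left (hle hi), max_eq_right (hle hi)]
    have hcol := hrow
    simp only [min_comm _ (((n + 1 : ℕ) : ℝ) / M), max_comm _ (((n + 1 : ℕ) : ℝ) / M)] at hcol
    simp only [sum_Icc_succ_top (Nat.le_add_left 1 n), sum_add_distrib]
    rw [ih, hrow, hcol, min_self, max_self]
    push_cast
    field_simp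
    ring

theorem stdPDF_eq_gaussianPDFReal : stdPDF = gaussianPDFReal 0 1 := by
  ext x
  simp [stdPDF, gaussianPDFReal, div_eq_inv_mul]

theorem integrable_stdPDF : Integrable stdPDF :=
  stdPDF_eq_gaussianPDFReal ▸ integrable_gaussianPDFReal 0 1

theorem integral_stdPDF : ∫ x, stdPDF x = 1 :=
  stdPDF_eq_gaussianPDFReal ▸ integral_gaussianPDFReal_eq_one 0 one_ne_zero

theorem stdPDF_pos (x : ℝ) : 0 < stdPDF x := by
  unfold stdPDF
  positivity

theorem stdPDF_le_one (x : ℝ) : stdPDF x ≤ 1 := by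
  have h : 1 ≤ √(2 * π) := Real.one_le_sqrt.2 (by linarith [Real.pi_gt_three])
  refine (div_le_one (by positivity)).2 (le_trans (Real.exp_le_one_iff.2 ?_) h)
  nlinarith [sq_nonneg x]

theorem continuous_stdPDF : Continuous stdPDF := by
  unfold stdPDF
  fun_prop

theorem integral_stdPDF_mul_self : ∫ x, stdPDF x * stdPDF x = 1 / (2 * √π) := by
  have h (x : ℝ) : stdPDF x * stdPDF x = Real.exp (-1 * x ^ 2) / (2 * π) := by
    rw [stdPDF, div_mul_div_comm, ← Real.exp_add, Real.mul_self_sqrt (by positivity)]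
    ring_nf
  simp only [h]
  rw [integral_div, integral_gaussian, div_one]
  nth_rewrite 2 [← Real.mul_self_sqrt Real.pi_pos.le]
  field_simp

theorem hasDerivAt_stdCDF (x : ℝ) : HasDerivAt stdCDF (stdPDF x) x := by
  have h : stdCDF = fun y => stdCDF 0 + ∫ t in (0 : ℝ)..y, stdPDF t := by
    ext y
    rw [← intervalIntegral.integral_Iic_sub_Iic integrable_stdPDF.integrableOn
      integrable_stdPDF.integrableOn]
    simp [stdCDF]
  rw [h]
  exact (intervalIntegral.integral_hasDerivAt_right integrable_stdPDF.intervalIntegrable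
    continuous_stdPDF.stronglyMeasurable.stronglyMeasurableAtFilter
    continuous_stdPDF.continuousAt).const_add _

theorem strictMono_stdCDF : StrictMono stdCDF :=
  strictMono_of_deriv_pos fun x => (hasDerivAt_stdCDF x).deriv ▸ stdPDF_pos x

theorem tendsto_stdCDF_atBot : Tendsto stdCDF atBot (𝓝 0) :=
  tendsto_integral_Iic_zero tendsto_id

theorem tendsto_stdCDF_atTop : Tendsto stdCDF atTop (𝓝 1) :=
  integral_stdPDF ▸
    (aecover_Iic tendsto_id).integral_tendsto_of_countably_generated integrable_stdPDF

theorem range_stdCDF : Set.range stdCDF = Set.Ioo 0 1 := by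
  refine Set.Subset.antisymm ?_ fun y hy => ?_
  · rintro _ ⟨x, rfl⟩
    exact ⟨(strictMono_stdCDF.monotone.le_of_tendsto tendsto_stdCDF_atBot (x - 1)).trans_lt
        (strictMono_stdCDF (by linarith)),
      (strictMono_stdCDF (by linarith)).trans_le
        (strictMono_stdCDF.monotone.ge_of_tendsto tendsto_stdCDF_atTop (x + 1))⟩
  · have hcont : Continuous stdCDF :=
      continuous_iff_continuousAt.2 fun x => (hasDerivAt_stdCDF x).continuousAt
    exact mem_range_of_exists_le_of_exists_ge hcont
      ((tendsto_stdCDF_atBot.eventually_le_const hy.1).exists)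
      ((tendsto_stdCDF_atTop.eventually_const_le hy.2).exists)

theorem stdQuantile_stdCDF (x : ℝ) : stdQuantile (stdCDF x) = x :=
  Function.leftInverse_invFun strictMono_stdCDF.injective x

theorem continuousOn_stdQuantile : ContinuousOn stdQuantile (Set.Ioo 0 1) := by
  have hmono : StrictMonoOn stdQuantile (Set.Ioo 0 1) := by
    rw [← range_stdCDF]
    rintro _ ⟨x, rfl⟩ _ ⟨y, rfl⟩ hxy
    simpa only [stdQuantile_stdCDF] using strictMono_stdCDF.lt_iff_lt.1 hxy
  have himage : stdQuantile '' Set.Ioo 0 1 = Set.univ := by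
    rw [← range_stdCDF, ← Set.range_comp]
    exact Set.range_eq_univ.2 fun x => ⟨x, stdQuantile_stdCDF x⟩
  intro x hx
  exact (hmono.continuousAt_of_image_mem_nhds (isOpen_Ioo.mem_nhds hx)
    (himage ▸ univ_mem)).continuousWithinAt

theorem integral_stdPDF_stdQuantile :
    ∫ u in Set.Ioo (0 : ℝ) 1, stdPDF (stdQuantile u) = 1 / (2 * √π) := by
  rw [← range_stdCDF, ← Set.image_univ, integral_image_eq_integral_abs_deriv_smul
    MeasurableSet.univ (fun x _ => (hasDerivAt_stdCDF x).hasDerivWithinAt)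
    strictMono_stdCDF.injective.injOn]
  simp only [stdQuantile_stdCDF, abs_of_pos (stdPDF_pos _), smul_eq_mul, Measure.restrict_univ,
    integral_stdPDF_mul_self]

theorem tendsto_sum_stdPDF_quantile_div :
    Tendsto (fun K : ℕ => (∑ k ∈ Icc 1 K, stdPDF (Δq K k)) / ((K : ℝ) + 1)) atTop
      (𝓝 (1 / (2 * √π))) := by
  have h := tendsto_riemannSum_of_continuousOn_Ioo (g := fun u => stdPDF (stdQuantile u))
    (fun x => (abs_of_pos (stdPDF_pos _)).trans_le (stdPDF_le_one _))
    (continuous_stdPDF.comp_continuousOn continuousOn_stdQuantile)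
  rw [integral_stdPDF_stdQuantile] at h
  have h0 := (tendsto_one_div_add_atTop_nhds_zero_nat (𝕜 := ℝ)).const_mul (stdPDF (stdQuantile 0))
  have h' := h.sub h0
  rw [mul_zero, sub_zero] at h'
  refine h'.congr fun K => ?_
  rw [range_eq_Ico, sum_eq_sum_Ico_succ_bot K.succ_pos, Nat.cast_zero, zero_div]
  simp only [Δq, zero_add, Nat.succ_eq_add_one, Ico_add_one_right_eq_Icc]
  ring

theorem vrmomVarConst_eq (K : ℕ) :
    vrmomVarConst K = (1 - (1 / ((K : ℝ) + 1)) ^ 2) / 12 /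
      ((∑ k ∈ Icc 1 K, stdPDF (Δq K k)) / ((K : ℝ) + 1)) ^ 2 := by
  have hK : (0 : ℝ) < (K : ℝ) + 1 := by positivity
  rw [vrmomVarConst, sum_min_mul_one_sub_max hK,
    div_pow (∑ k ∈ Icc 1 K, stdPDF (Δq K k)), div_div_eq_mul_div]
  congr 1
  field_simp
  ring

/-- **Limit of the VRMOM asymptotic variance constant (Theorem 1 / Lemma B.1).**
With `τ_k = k/(K+1)`, `Δ_k = Φ⁻¹(τ_k)` and
`σ_K² = [Σ_{k₁,k₂} min(τ_{k₁},τ_{k₂})(1 - max(τ_{k₁},τ_{k₂}))] / [Σ_k ψ(Δ_k)]²`,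
one has `σ_K² → π/3` as `K → ∞`. -/
theorem vrmom_variance_constant_limit :
    Tendsto (fun K => vrmomVarConst K) atTop (𝓝 (Real.pi / 3)) := by
  have hnum : Tendsto (fun K : ℕ => (1 - (1 / ((K : ℝ) + 1)) ^ 2) / 12) atTop
      (𝓝 ((1 - 0 ^ 2) / 12)) :=
    (((tendsto_one_div_add_atTop_nhds_zero_nat (𝕜 := ℝ)).pow 2).const_sub 1).div_const 12
  have hlim := hnum.div (tendsto_sum_stdPDF_quantile_div.pow 2) (by positivity)
  have hval : ((1 - 0 ^ 2) / 12 : ℝ) / (1 / (2 * √π)) ^ 2 = π / 3 := by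
    rw [div_pow, mul_pow, Real.sq_sqrt Real.pi_pos.le]
    field_simp
    norm_num
  rw [hval] at hlim
  exact hlim.congr fun K => (vrmomVarConst_eq K).symm

end
end
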